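/- arXiv:2410.04861 — 7 statements merged into one kernel-verified Lean document; each statement's English description precedes it below -/
import Mathlib

section
/- For every bounded Lipschitz function f : H → ℝ, the mapping [0,∞) × H ∋ (t,x) ↦ P_t f(x) ∈ ℝ is jointly continuous (with the norm topology on H). -/
open MeasureTheory Filter
open scoped ENNReal Topology

theorem stmt1
    {H : Type*} [NormedAddCommGroup H] [InnerProductSpace ℝ H] [CompleteSpace H]
    [SecondCountableTopology H] [MeasurableSpace H] [BorelSpace H]
    (T : ℝ → H →L[ℝ] H)
    (hT0 : T 0 = ContinuousLinearMap.id ℝ H)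
    (hTsg : ∀ s t : ℝ, 0 ≤ s → 0 ≤ t → T (t + s) = (T t).comp (T s))
    (hTcont : ∀ x : H, ContinuousOn (fun t => T t x) (Set.Ici (0 : ℝ)))
    (μ : ℝ → Measure H) [∀ t, IsProbabilityMeasure (μ t)]
    (hμ0 : μ 0 = Measure.dirac 0)
    (hμw : ∀ f : H → ℝ, Continuous f → (∃ C, ∀ x, |f x| ≤ C) →
      ContinuousOn (fun t => ∫ y, f y ∂ μ t) (Set.Ici (0 : ℝ)))
    (hμconv : ∀ s t : ℝ, 0 ≤ s → 0 ≤ t →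
      μ (t + s) = Measure.map (fun yz : H × H => yz.1 + yz.2)
        (((μ t).map (T s)).prod (μ s)))
    (M ω : ℝ) (hM : 1 ≤ M) (hω : 0 ≤ ω)
    (hTbound : ∀ (x : H) (t : ℝ), 0 ≤ t → ‖T t x‖ ≤ M * Real.exp (ω * t) * ‖x‖)
    (f : H → ℝ) (C : ℝ) (hfb : ∀ x, |f x| ≤ C)
    (L : ℝ) (hL : 0 ≤ L) (hfLip : ∀ x x' : H, |f x - f x'| ≤ L * ‖x - x'‖) :
    ContinuousOn (fun p : ℝ × H => ∫ y, f (T p.1 p.2 + y) ∂ μ p.1)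
      (Set.Ici (0 : ℝ) ×ˢ (Set.univ : Set H)) := by
  rintro ⟨t₀, x₀⟩ ⟨ht₀, -⟩
  have ht₀' : (0 : ℝ) ≤ t₀ := ht₀
  have hf : Continuous f := by
    refine (LipschitzWith.of_dist_le_mul (K := ⟨L, hL⟩) fun x y => ?_).continuous
    rw [Real.dist_eq, dist_eq_norm]
    exact hfLip x y
  have hint : ∀ (a : H) (t : ℝ), Integrable (fun y => f (a + y)) (μ t) := fun a t =>
    Integrable.of_bound (hf.comp (continuous_const_add a)).aestronglyMeasurable C
      (ae_of_all _ fun y => hfb (a + y))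
  set l := 𝓝[Set.Ici (0 : ℝ) ×ˢ (Set.univ : Set H)] (t₀, x₀) with hl
  have hmem : ∀ᶠ p in l, (0 : ℝ) ≤ p.1 :=
    eventually_nhdsWithin_of_forall fun p hp => hp.1
  have hfst : Tendsto Prod.fst l (𝓝[Set.Ici (0 : ℝ)] t₀) :=
    tendsto_nhdsWithin_iff.2
      ⟨(continuous_fst.tendsto (t₀, x₀)).mono_left nhdsWithin_le_nhds, hmem⟩
  have hpair : Tendsto (fun p : ℝ × H => p) l (𝓝 (t₀, x₀)) := nhdsWithin_le_nhds
  have horbit : Tendsto (fun p : ℝ × H => T p.1 x₀) l (𝓝 (T t₀ x₀)) :=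
    (hTcont x₀ t₀ ht₀').tendsto.comp hfst
  have hweak : Tendsto (fun p : ℝ × H => ∫ y, f (T t₀ x₀ + y) ∂ μ p.1) l
      (𝓝 (∫ y, f (T t₀ x₀ + y) ∂ μ t₀)) :=
    (hμw (fun y => f (T t₀ x₀ + y)) (hf.comp (continuous_const_add _))
      ⟨C, fun y => hfb _⟩ t₀ ht₀').tendsto.comp hfst
  have hbound : Tendsto (fun p : ℝ × H => L * (M * Real.exp (ω * p.1) * ‖p.2 - x₀‖
      + ‖T p.1 x₀ - T t₀ x₀‖)) l (𝓝 0) := by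
    have h₁ : Tendsto (fun p : ℝ × H => M * Real.exp (ω * p.1) * ‖p.2 - x₀‖) l
        (𝓝 (M * Real.exp (ω * t₀) * ‖x₀ - x₀‖)) :=
      ((by fun_prop : Continuous fun p : ℝ × H =>
        M * Real.exp (ω * p.1) * ‖p.2 - x₀‖).tendsto (t₀, x₀)).comp hpair
    have h₂ := (horbit.sub_const (T t₀ x₀)).norm
    simpa using (h₁.add h₂).const_mul L
  have hdiff : Tendsto (fun p : ℝ × H => (∫ y, f (T p.1 p.2 + y) ∂ μ p.1)
      - ∫ y, f (T t₀ x₀ + y) ∂ μ p.1) l (𝓝 0) := by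
    refine squeeze_zero_norm' ?_ hbound
    filter_upwards [hmem] with p hp
    have hT : ‖T p.1 p.2 - T t₀ x₀‖
        ≤ M * Real.exp (ω * p.1) * ‖p.2 - x₀‖ + ‖T p.1 x₀ - T t₀ x₀‖ := by
      have h := hTbound (p.2 - x₀) p.1 hp
      rw [map_sub] at h
      exact (norm_sub_le_norm_sub_add_norm_sub _ (T p.1 x₀) _).trans (by gcongr)
    rw [← integral_sub (hint _ _) (hint _ _)]
    refine (norm_integral_le_of_norm_le_const
      (C := L * ‖T p.1 p.2 - T t₀ x₀‖) (ae_of_all _ fun y => ?_)).trans ?_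
    · simpa using hfLip (T p.1 p.2 + y) (T t₀ x₀ + y)
    · simpa using mul_le_mul_of_nonneg_left hT hL
  simpa [ContinuousWithinAt] using hdiff.add hweak
end

section
/- For every t ≥ 0, P_t maps bounded sequentially weakly continuous Borel functions into bounded sequentially weakly continuous functions: if f : H → ℝ is bounded, Borel measurable, and satisfies f(x_n) → f(x) whenever ⟨x_n, y⟩ → ⟨x, y⟩ for all y ∈ H, then P_t f is bounded and has the same property. -/
open MeasureTheory Filter
open scoped ENNReal Topology RealInnerProductSpace

theorem stmt4
    {H : Type*} [NormedAddCommGroup H] [InnerProductSpace ℝ H] [CompleteSpace H]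
    [SecondCountableTopology H] [MeasurableSpace H] [BorelSpace H]
    (T : ℝ → H →L[ℝ] H)
    (hT0 : T 0 = ContinuousLinearMap.id ℝ H)
    (hTsg : ∀ s t : ℝ, 0 ≤ s → 0 ≤ t → T (t + s) = (T t).comp (T s))
    (hTcont : ∀ x : H, ContinuousOn (fun t => T t x) (Set.Ici (0 : ℝ)))
    (μ : ℝ → Measure H) [∀ t, IsProbabilityMeasure (μ t)]
    (hμ0 : μ 0 = Measure.dirac 0)
    (hμw : ∀ f : H → ℝ, Continuous f → (∃ C, ∀ x, |f x| ≤ C) →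
      ContinuousOn (fun t => ∫ y, f y ∂ μ t) (Set.Ici (0 : ℝ)))
    (hμconv : ∀ s t : ℝ, 0 ≤ s → 0 ≤ t →
      μ (t + s) = Measure.map (fun yz : H × H => yz.1 + yz.2)
        (((μ t).map (T s)).prod (μ s)))
    (t : ℝ) (ht : 0 ≤ t)
    (f : H → ℝ) (hfm : Measurable f) (C : ℝ) (hfb : ∀ x, |f x| ≤ C)
    (hfw : ∀ (x : ℕ → H) (x₀ : H),
      (∀ y : H, Tendsto (fun n => ⟪x n, y⟫) atTop (nhds ⟪x₀, y⟫)) →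
      Tendsto (fun n => f (x n)) atTop (nhds (f x₀))) :
    (∀ x : H, |∫ y, f (T t x + y) ∂ μ t| ≤ C) ∧
    (∀ (x : ℕ → H) (x₀ : H),
      (∀ y : H, Tendsto (fun n => ⟪x n, y⟫) atTop (nhds ⟪x₀, y⟫)) →
      Tendsto (fun n => ∫ y, f (T t (x n) + y) ∂ μ t) atTop
        (nhds (∫ y, f (T t x₀ + y) ∂ μ t))) := by
  refine ⟨fun x => ?_, fun x x₀ hx => ?_⟩
  · simpa using norm_integral_le_of_norm_le_const (μ := μ t)
      (Eventually.of_forall fun y => (Real.norm_eq_abs _).trans_le (hfb (T t x + y)))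
  · refine tendsto_integral_of_dominated_convergence (fun _ => C)
      (fun n => (hfm.comp (measurable_const_add _)).aestronglyMeasurable)
      (integrable_const C)
      (fun n => Eventually.of_forall fun y => (Real.norm_eq_abs _).trans_le (hfb _))
      (Eventually.of_forall fun y => hfw _ _ fun z => ?_)
    simp only [inner_add_left, ← ContinuousLinearMap.adjoint_inner_right]
    exact (hx _).add_const _
end

section
/- Let t ≥ 0 be such that the operator T_t is a compact operator on H. Then for every bounded norm-continuous function f : H → ℝ, the function P_t f is bounded and sequentially weakly continuous. -/
open MeasureTheory Filter
open scoped ENNReal Topology RealInnerProductSpace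

/-- A weakly convergent sequence in a Hilbert space is bounded. -/
theorem exists_norm_le_of_tendsto_inner
    {H : Type*} [NormedAddCommGroup H] [InnerProductSpace ℝ H] [CompleteSpace H]
    {x : ℕ → H} {x₀ : H}
    (hx : ∀ y : H, Tendsto (fun n => ⟪x n, y⟫) atTop (𝓝 ⟪x₀, y⟫)) :
    ∃ R, ∀ n, ‖x n‖ ≤ R := by
  obtain ⟨R, hR⟩ := banach_steinhaus (g := fun n => innerSL ℝ (x n)) fun y => by
    obtain ⟨B, hB⟩ := (Metric.isBounded_range_of_tendsto _ (hx y)).exists_norm_le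
    exact ⟨B, fun n => hB _ ⟨n, rfl⟩⟩
  exact ⟨R, fun n => by simpa using hR n⟩

/-- A compact operator maps weakly convergent sequences to norm-convergent ones. -/
theorem IsCompactOperator.tendsto_of_tendsto_inner
    {H : Type*} [NormedAddCommGroup H] [InnerProductSpace ℝ H] [CompleteSpace H]
    {A : H →L[ℝ] H} (hA : IsCompactOperator A) {x : ℕ → H} {x₀ : H}
    (hx : ∀ y : H, Tendsto (fun n => ⟪x n, y⟫) atTop (𝓝 ⟪x₀, y⟫)) :
    Tendsto (fun n => A (x n)) atTop (𝓝 (A x₀)) := by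
  obtain ⟨R, hR⟩ := exists_norm_le_of_tendsto_inner hx
  obtain ⟨K, hK, hAK⟩ := IsCompactOperator.image_closedBall_subset_compact
    (f := (A : H →ₗ[ℝ] H)) hA R
  refine hK.tendsto_nhds_of_unique_mapClusterPt
    (Eventually.of_forall fun n => hAK ⟨x n, by simpa using hR n, rfl⟩) fun z _ hz => ?_
  refine ext_inner_right ℝ fun y => ?_
  have hcluster : MapClusterPt ⟪z, y⟫ atTop fun n => ⟪A (x n), y⟫ :=
    hz.continuousAt_comp (f := fun w => ⟪w, y⟫) (by fun_prop)
  have hlim : Tendsto (fun n => ⟪A (x n), y⟫) atTop (𝓝 ⟪A x₀, y⟫) := by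
    simpa only [ContinuousLinearMap.adjoint_inner_right] using
      hx (ContinuousLinearMap.adjoint A y)
  exact eq_of_nhds_neBot (hcluster.neBot.mono (inf_le_inf_left _ hlim))

theorem stmt5
    {H : Type*} [NormedAddCommGroup H] [InnerProductSpace ℝ H] [CompleteSpace H]
    [SecondCountableTopology H] [MeasurableSpace H] [BorelSpace H]
    (T : ℝ → H →L[ℝ] H)
    (hT0 : T 0 = ContinuousLinearMap.id ℝ H)
    (hTsg : ∀ s t : ℝ, 0 ≤ s → 0 ≤ t → T (t + s) = (T t).comp (T s))
    (hTcont : ∀ x : H, ContinuousOn (fun t => T t x) (Set.Ici (0 : ℝ)))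
    (μ : ℝ → Measure H) [∀ t, IsProbabilityMeasure (μ t)]
    (hμ0 : μ 0 = Measure.dirac 0)
    (hμw : ∀ f : H → ℝ, Continuous f → (∃ C, ∀ x, |f x| ≤ C) →
      ContinuousOn (fun t => ∫ y, f y ∂ μ t) (Set.Ici (0 : ℝ)))
    (hμconv : ∀ s t : ℝ, 0 ≤ s → 0 ≤ t →
      μ (t + s) = Measure.map (fun yz : H × H => yz.1 + yz.2)
        (((μ t).map (T s)).prod (μ s)))
    (t : ℝ) (ht : 0 ≤ t) (hTcomp : IsCompactOperator (T t))
    (f : H → ℝ) (hfc : Continuous f) (C : ℝ) (hfb : ∀ x, |f x| ≤ C) :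
    (∀ x : H, |∫ y, f (T t x + y) ∂ μ t| ≤ C) ∧
    (∀ (x : ℕ → H) (x₀ : H),
      (∀ y : H, Tendsto (fun n => ⟪x n, y⟫) atTop (nhds ⟪x₀, y⟫)) →
      Tendsto (fun n => ∫ y, f (T t (x n) + y) ∂ μ t) atTop
        (nhds (∫ y, f (T t x₀ + y) ∂ μ t))) := by
  refine ⟨fun x => ?_, fun x x₀ hx => ?_⟩
  · simpa using norm_integral_le_of_norm_le_const (μ := μ t) (f := fun y => f (T t x + y))
      (Eventually.of_forall fun y => hfb (T t x + y) : ∀ᵐ y ∂μ t, ‖f (T t x + y)‖ ≤ C)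
  · have hlim := hTcomp.tendsto_of_tendsto_inner hx
    exact tendsto_integral_of_dominated_convergence (fun _ => C)
      (fun n => (hfc.comp (continuous_const.add continuous_id)).aestronglyMeasurable)
      (integrable_const C) (fun n => Eventually.of_forall fun y => hfb _)
      (Eventually.of_forall fun y => (hfc.tendsto _).comp (hlim.add_const y))
end

section
/- Under assumption (H_{A,μ}) and with the choice of weights (γ_i), the Lyapunov function V satisfies the lower bound V(x) ≥ 2^{1−p} Σ_{i≥1} (|λ_i|^{1+a} / (q + p|λ_i|)) (|⟨x,e_i⟩|^p ∧ 1) − c_1 for every x ∈ H. -/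
open MeasureTheory Filter
open scoped ENNReal Topology RealInnerProductSpace

/-- Sums of lower integrals are bounded by the lower integral of the sum, with no measurability
assumption. -/
lemma tsum_lintegral_le_lintegral_tsum {α ι : Type*} [MeasurableSpace α] (ν : Measure α)
    (f : ι → α → ℝ≥0∞) : ∑' i, ∫⁻ x, f i x ∂ν ≤ ∫⁻ x, ∑' i, f i x ∂ν := by
  classical
  rw [ENNReal.tsum_eq_iSup_sum]
  refine iSup_le fun s => ?_
  refine le_trans ?_ (lintegral_mono fun x => ENNReal.sum_le_tsum s)
  induction s using Finset.induction_on with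
  | empty => simp
  | insert i s hi ih =>
    simp only [Finset.sum_insert hi]
    exact (add_le_add_right ih _).trans (le_lintegral_add _ _)

/-- A truncated form of `|s| ^ p ≤ 2 ^ (p - 1) * (|s + y| ^ p + |y| ^ p)`. -/
lemma two_rpow_mul_min_abs_rpow_le {p : ℝ} (hp : 1 ≤ p) (s y : ℝ) :
    (2 : ℝ) ^ (1 - p) * min (|s| ^ p) 1 ≤ min (|s + y| ^ p) 1 + min (|y| ^ p) 1 := by
  have h2 : (2 : ℝ) ^ (1 - p) ≤ 1 := Real.rpow_le_one_of_one_le_of_nonpos one_le_two (by linarith)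
  have h20 : (0 : ℝ) < 2 ^ (1 - p) := by positivity
  have hs : 0 ≤ |s + y| ^ p := by positivity
  have hy : 0 ≤ |y| ^ p := by positivity
  have hm : (2 : ℝ) ^ (1 - p) * min (|s| ^ p) 1 ≤ 1 := by
    have : min (|s| ^ p) 1 ≤ 1 := min_le_right _ _
    nlinarith
  rcases le_total 1 (|s + y| ^ p) with h | h
  · rw [min_eq_right h]
    have : 0 ≤ min (|y| ^ p) 1 := le_min hy zero_le_one
    linarith
  rcases le_total 1 (|y| ^ p) with h' | h'
  · rw [min_eq_right h']
    have : 0 ≤ min (|s + y| ^ p) 1 := le_min hs zero_le_one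
    linarith
  rw [min_eq_left h, min_eq_left h']
  have hconv : |s| ^ p ≤ 2 ^ (p - 1) * (|s + y| ^ p + |y| ^ p) := by
    have htri : |s| ≤ |s + y| + |y| := by simpa using abs_sub (s + y) y
    refine (Real.rpow_le_rpow (abs_nonneg _) htri (by linarith)).trans ?_
    exact_mod_cast NNReal.rpow_add_le_mul_rpow_add_rpow ⟨|s + y|, abs_nonneg _⟩
      ⟨|y|, abs_nonneg _⟩ hp
  calc (2 : ℝ) ^ (1 - p) * min (|s| ^ p) 1
      ≤ 2 ^ (1 - p) * (2 ^ (p - 1) * (|s + y| ^ p + |y| ^ p)) := by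
        gcongr
        exact (min_le_left _ _).trans hconv
    _ = |s + y| ^ p + |y| ^ p := by
        rw [← mul_assoc, ← Real.rpow_add two_pos]
        simp

lemma exp_mul_min_abs_rpow_le {p : ℝ} (hp : 0 ≤ p) (l u : ℝ) {t : ℝ} (ht : 0 ≤ t) :
    Real.exp (-(p * |l| * t)) * min (|u| ^ p) 1 ≤ min (|Real.exp (l * t) * u| ^ p) 1 := by
  have hle : Real.exp (-(p * |l| * t)) ≤ 1 := Real.exp_le_one_iff.2 (by
    have : 0 ≤ p * |l| * t := by positivity
    linarith)
  refine le_min ?_ ?_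
  · rw [abs_mul, Real.mul_rpow (abs_nonneg _) (abs_nonneg _), Real.abs_exp, ← Real.exp_mul]
    refine mul_le_mul (Real.exp_le_exp.2 ?_) (min_le_left _ _)
      (le_min (by positivity) zero_le_one) (Real.exp_nonneg _)
    nlinarith [neg_abs_le l, mul_nonneg hp ht]
  · exact mul_le_one₀ hle (le_min (by positivity) zero_le_one) (min_le_right _ _)

lemma lintegral_ofReal_mul_exp_neg_Ioi {c r : ℝ} (hc : 0 ≤ c) (hr : 0 < r) :
    ∫⁻ t in Set.Ioi (0 : ℝ), ENNReal.ofReal (c * Real.exp (-r * t)) = ENNReal.ofReal (c / r) := by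
  rw [← ofReal_integral_eq_lintegral_ofReal, integral_const_mul,
    integral_exp_mul_Ioi (neg_lt_zero.2 hr)]
  · congr 1
    simp
    ring
  · exact (exp_neg_integrableOn_Ioi 0 hr).const_mul c
  · exact ae_of_all _ fun t => by positivity

/-- Truncated moments depend measurably on `t` if the measures are weakly continuous in `t`. -/
lemma aemeasurable_lintegral_of_continuousOn_integral {H : Type*} [TopologicalSpace H]
    [MeasurableSpace H] [BorelSpace H] (μ : ℝ → Measure H)
    [∀ t, IsProbabilityMeasure (μ t)]
    (hμw : ∀ f : H → ℝ, Continuous f → (∃ C, ∀ x, |f x| ≤ C) →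
      ContinuousOn (fun t => ∫ y, f y ∂ μ t) (Set.Ici (0 : ℝ)))
    {f : H → ℝ} (hf : Continuous f) (hf0 : ∀ x, 0 ≤ f x) {C : ℝ} (hfC : ∀ x, f x ≤ C) :
    AEMeasurable (fun t => ∫⁻ y, ENNReal.ofReal (f y) ∂ μ t)
      (volume.restrict (Set.Ioi (0 : ℝ))) := by
  have habs : ∀ x, |f x| ≤ C := fun x => by rw [abs_of_nonneg (hf0 x)]; exact hfC x
  have heq : (fun t => ∫⁻ y, ENNReal.ofReal (f y) ∂ μ t)
      = fun t => ENNReal.ofReal (∫ y, f y ∂ μ t) := by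
    funext t
    rw [ofReal_integral_eq_lintegral_ofReal _ (ae_of_all _ hf0)]
    exact Integrable.of_bound hf.measurable.aestronglyMeasurable C (ae_of_all _ habs)
  rw [heq]
  exact (((hμw f hf ⟨C, habs⟩).mono Set.Ioi_subset_Ici_self).aemeasurable
    measurableSet_Ioi).ennreal_ofReal

theorem stmt10
    {H : Type*} [NormedAddCommGroup H] [InnerProductSpace ℝ H] [CompleteSpace H]
    [SecondCountableTopology H] [MeasurableSpace H] [BorelSpace H]
    (b : HilbertBasis ℕ ℝ H)
    (lam : ℕ → ℝ) (hlamne : ∀ i, lam i ≠ 0) (hlamanti : Antitone lam)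
    (hlamtop : Tendsto lam atTop atBot)
    (T : ℝ → H →L[ℝ] H)
    (hT0 : T 0 = ContinuousLinearMap.id ℝ H)
    (hTsg : ∀ s t : ℝ, 0 ≤ s → 0 ≤ t → T (t + s) = (T t).comp (T s))
    (hTcont : ∀ x : H, ContinuousOn (fun t => T t x) (Set.Ici (0 : ℝ)))
    (hTeig : ∀ t : ℝ, 0 ≤ t → ∀ (x : H) (i : ℕ),
      ⟪T t x, b i⟫ = Real.exp (lam i * t) * ⟪x, b i⟫)
    (μ : ℝ → Measure H) [∀ t, IsProbabilityMeasure (μ t)]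
    (hμ0 : μ 0 = Measure.dirac 0)
    (hμw : ∀ f : H → ℝ, Continuous f → (∃ C, ∀ x, |f x| ≤ C) →
      ContinuousOn (fun t => ∫ y, f y ∂ μ t) (Set.Ici (0 : ℝ)))
    (hμconv : ∀ s t : ℝ, 0 ≤ s → 0 ≤ t →
      μ (t + s) = Measure.map (fun yz : H × H => yz.1 + yz.2)
        (((μ t).map (T s)).prod (μ s)))
    (p a q γ : ℝ) (hp : 2 < p) (ha : 0 < a) (hq : p * lam 0 < q)
    (hγ0 : 0 < γ) (hγ1 : γ ≤ 1)
    (c1 : ℝ≥0∞)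
    (hc1def : c1 = ∑' i : ℕ, ENNReal.ofReal (|lam i| ^ (1 + a)) *
      ∫⁻ t in Set.Ioi (0 : ℝ), ENNReal.ofReal (Real.exp (-(q * t))) *
        ∫⁻ y, ENNReal.ofReal (min (|⟪y, b i⟫| ^ p) 1) ∂ μ t)
    (hc1 : c1 ≠ ⊤)
    (hsum1 : ∀ t : ℝ, 0 < t → Summable fun i => |lam i| ^ a * Real.exp (p * lam i * t))
    (hsum2 : Summable fun i => |lam i| ^ (-(2 * a / (p - 2))))
    (hmom : ∀ i : ℕ, (∫⁻ t in Set.Ioi (0 : ℝ), ENNReal.ofReal (Real.exp (-(q * t))) *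
        ∫⁻ y, ENNReal.ofReal (|⟪y, b i⟫| ^ γ) ∂ μ t) ≠ ⊤)
    (g : ℕ → ℝ) (hg0 : ∀ i, 0 < g i) (hg1 : ∀ i, g i ≤ 1) (hganti : Antitone g)
    (hgsum : Summable fun i => g i ^ (2 / (2 - γ)))
    (c2 : ℝ≥0∞)
    (hc2def : c2 = ∑' i : ℕ, ENNReal.ofReal (g i) *
      ∫⁻ t in Set.Ioi (0 : ℝ), ENNReal.ofReal (Real.exp (-(q * t))) *
        ∫⁻ y, ENNReal.ofReal (|⟪y, b i⟫| ^ γ) ∂ μ t)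
    (hc2 : c2 ≠ ⊤)
    (v : H → ℝ≥0∞)
    (hvdef : ∀ x : H, v x
      = (∑' i : ℕ, ENNReal.ofReal (|lam i| ^ (1 + a) * min (|⟪x, b i⟫| ^ p) 1))
        + ∑' i : ℕ, ENNReal.ofReal (g i * |⟪x, b i⟫| ^ γ))
    (V : H → ℝ≥0∞)
    (hVdef : ∀ x : H, V x = ∫⁻ t in Set.Ioi (0 : ℝ),
      ENNReal.ofReal (Real.exp (-(q * t))) * ∫⁻ y, v (T t x + y) ∂ μ t)
    (H0 : Set H)
    (hH0 : H0 = {x : H | Summable fun i => |lam i| ^ a * |⟪x, b i⟫| ^ p})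
    :
    ∀ x : H,
      (∑' i : ℕ, ENNReal.ofReal ((2 : ℝ) ^ (1 - p)
          * (|lam i| ^ (1 + a) / (q + p * |lam i|)) * min (|⟪x, b i⟫| ^ p) 1))
        ≤ V x + c1 := by
  intro x
  have hp0 : 0 < p := by linarith
  set A : ℕ → ℝ → ℝ≥0∞ := fun i t => ENNReal.ofReal (Real.exp (-(q * t))) *
    ∫⁻ y, ENNReal.ofReal (|lam i| ^ (1 + a) * min (|⟪T t x + y, b i⟫| ^ p) 1) ∂ μ t with hA
  set B : ℕ → ℝ → ℝ≥0∞ := fun i t => ENNReal.ofReal (Real.exp (-(q * t))) *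
    ∫⁻ y, ENNReal.ofReal (min (|⟪y, b i⟫| ^ p) 1) ∂ μ t with hB
  have hcoord (i : ℕ) (z : H) : Continuous fun y : H => min (|⟪z + y, b i⟫| ^ p) 1 := by
    have : Continuous fun y : H => |⟪z + y, b i⟫| := by fun_prop
    exact (this.rpow_const fun _ => Or.inr hp0.le).min continuous_const
  have hmin0 (u : ℝ) : 0 ≤ min (|u| ^ p) 1 := le_min (by positivity) zero_le_one
  have hBmeas (i : ℕ) : AEMeasurable (B i) (volume.restrict (Set.Ioi (0 : ℝ))) := by
    refine AEMeasurable.mul (by fun_prop) ?_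
    exact aemeasurable_lintegral_of_continuousOn_integral μ hμw
      (by simpa using hcoord i 0) (fun _ => hmin0 _) (fun _ => min_le_right _ _)
  have hr (i : ℕ) : 0 < q + p * |lam i| := by
    have h0 := mul_le_mul_of_nonneg_left (hlamanti (Nat.zero_le i)) hp0.le
    have h1 := mul_le_mul_of_nonneg_left (neg_abs_le (lam i)) hp0.le
    linarith
  have hpt (i : ℕ) {t : ℝ} (ht : 0 < t) :
      ENNReal.ofReal ((2 ^ (1 - p) * |lam i| ^ (1 + a) * min (|⟪x, b i⟫| ^ p) 1)
        * Real.exp (-(q + p * |lam i|) * t))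
      ≤ A i t + ENNReal.ofReal (|lam i| ^ (1 + a)) * B i t := by
    have hw : 0 ≤ |lam i| ^ (1 + a) := by positivity
    have hreal (y : H) : 2 ^ (1 - p) * |lam i| ^ (1 + a) * min (|⟪x, b i⟫| ^ p) 1
          * Real.exp (-(p * |lam i| * t))
        ≤ |lam i| ^ (1 + a) * min (|⟪T t x + y, b i⟫| ^ p) 1
          + |lam i| ^ (1 + a) * min (|⟪y, b i⟫| ^ p) 1 := by
      have h1 := exp_mul_min_abs_rpow_le hp0.le (lam i) ⟪x, b i⟫ ht.le
      have h2 := two_rpow_mul_min_abs_rpow_le (p := p) (by linarith)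
        (Real.exp (lam i * t) * ⟪x, b i⟫) ⟪y, b i⟫
      rw [inner_add_left, hTeig t ht.le x i, ← mul_add]
      calc _ = |lam i| ^ (1 + a) * (2 ^ (1 - p)
            * (Real.exp (-(p * |lam i| * t)) * min (|⟪x, b i⟫| ^ p) 1)) := by ring
        _ ≤ |lam i| ^ (1 + a) * (2 ^ (1 - p)
            * min (|Real.exp (lam i * t) * ⟪x, b i⟫| ^ p) 1) := by gcongr
        _ ≤ _ := by gcongr
    have hmeas : Measurable fun y : H =>
        ENNReal.ofReal (|lam i| ^ (1 + a) * min (|⟪T t x + y, b i⟫| ^ p) 1) :=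
      ((hcoord i (T t x)).measurable.const_mul _).ennreal_ofReal
    have hmeas' : Measurable fun y : H => ENNReal.ofReal (min (|⟪y, b i⟫| ^ p) 1) := by
      simpa using (hcoord i 0).measurable.ennreal_ofReal
    have hexp : -(q + p * |lam i|) * t = -(q * t) + -(p * |lam i| * t) := by ring
    rw [hexp, Real.exp_add, mul_left_comm, ENNReal.ofReal_mul (Real.exp_nonneg _), hA, hB]
    simp only
    rw [mul_left_comm, ← mul_add, ← lintegral_const_mul _ hmeas', ← lintegral_add_left hmeas]
    gcongr
    rw [← mul_one (ENNReal.ofReal _), ← measure_univ (μ := μ t), ← lintegral_const]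
    refine lintegral_mono fun y => ?_
    rw [← ENNReal.ofReal_mul hw, ← ENNReal.ofReal_add (mul_nonneg hw (hmin0 _))
      (mul_nonneg hw (hmin0 _))]
    exact ENNReal.ofReal_le_ofReal (hreal y)
  have hterm (i : ℕ) : ENNReal.ofReal ((2 : ℝ) ^ (1 - p)
        * (|lam i| ^ (1 + a) / (q + p * |lam i|)) * min (|⟪x, b i⟫| ^ p) 1)
      ≤ (∫⁻ t in Set.Ioi (0 : ℝ), A i t)
        + ENNReal.ofReal (|lam i| ^ (1 + a)) * ∫⁻ t in Set.Ioi (0 : ℝ), B i t := by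
    have hc : 0 ≤ 2 ^ (1 - p) * |lam i| ^ (1 + a) * min (|⟪x, b i⟫| ^ p) 1 :=
      mul_nonneg (by positivity) (hmin0 _)
    rw [← lintegral_const_mul'' _ (hBmeas i), ← lintegral_add_right' _ ((hBmeas i).const_mul _)]
    calc _ = ENNReal.ofReal ((2 ^ (1 - p) * |lam i| ^ (1 + a) * min (|⟪x, b i⟫| ^ p) 1)
          / (q + p * |lam i|)) := by congr 1; ring
      _ = _ := (lintegral_ofReal_mul_exp_neg_Ioi hc (hr i)).symm
      _ ≤ _ := setLIntegral_mono' measurableSet_Ioi fun t ht => hpt i ht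
  have hV : ∑' i, ∫⁻ t in Set.Ioi (0 : ℝ), A i t ≤ V x := by
    rw [hVdef]
    refine (tsum_lintegral_le_lintegral_tsum _ A).trans (lintegral_mono fun t => ?_)
    simp only [hA]
    rw [ENNReal.tsum_mul_left]
    gcongr
    refine (tsum_lintegral_le_lintegral_tsum _ _).trans (lintegral_mono fun y => ?_)
    rw [hvdef]
    exact le_self_add
  calc _ ≤ _ := ENNReal.tsum_le_tsum hterm
    _ = (∑' i, ∫⁻ t in Set.Ioi (0 : ℝ), A i t) + c1 := by rw [ENNReal.tsum_add, hc1def]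
    _ ≤ V x + c1 := by gcongr
end

section
/- If c_1 := Σ_{i≥1} |λ_i|^{1+a} ∫_0^∞ e^{−qt} ∫_H (|⟨y,e_i⟩|^p ∧ 1) μ_t(dy) dt < ∞, then for Lebesgue-almost every t > 0 the measure μ_t is concentrated on H_0; more precisely, for a.e. t > 0, μ_t({y ∈ H : Σ_{i≥1} |λ_i|^a (|⟨y,e_i⟩|^p ∧ 1) = ∞}) = 0. -/
open MeasureTheory Filter
open scoped ENNReal Topology RealInnerProductSpace

/-- The integrals of a bounded nonnegative continuous function against a weakly continuous family
of probability measures depend almost-everywhere measurably on the parameter. -/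
theorem aemeasurable_lintegral_ofReal_of_weaklyContinuousOn
    {H : Type*} [TopologicalSpace H] [MeasurableSpace H] [OpensMeasurableSpace H]
    {s : Set ℝ} (hs : MeasurableSet s)
    (μ : ℝ → Measure H) [∀ t, IsProbabilityMeasure (μ t)]
    (hμw : ∀ f : H → ℝ, Continuous f → (∃ C, ∀ x, |f x| ≤ C) →
      ContinuousOn (fun t => ∫ y, f y ∂ μ t) s)
    {f : H → ℝ} (hf : Continuous f) (hf0 : ∀ y, 0 ≤ f y) {C : ℝ} (hC : ∀ y, f y ≤ C) :
    AEMeasurable (fun t => ∫⁻ y, ENNReal.ofReal (f y) ∂ μ t) (volume.restrict s) := by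
  have hbd : ∀ y, |f y| ≤ C := fun y => (abs_of_nonneg (hf0 y)).trans_le (hC y)
  have heq : (fun t => ∫⁻ y, ENNReal.ofReal (f y) ∂ μ t) =
      fun t => ENNReal.ofReal (∫ y, f y ∂ μ t) := by
    funext t
    refine (ofReal_integral_eq_lintegral_ofReal ?_ (ae_of_all _ hf0)).symm
    exact Integrable.of_bound hf.measurable.aestronglyMeasurable C (ae_of_all _ hbd)
  rw [heq]
  exact ((hμw f hf ⟨C, hbd⟩).aemeasurable hs).ennreal_ofReal

/-- Square-summability of the coordinates controls the indices with `|lam i| ≤ 1`, so the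
exponent `1 + a` may be lowered to `a`. -/
theorem summable_rpow_mul_min_of_tsum_ne_top {lam x : ℕ → ℝ} {p a : ℝ} (hp : 2 ≤ p) (ha : 0 < a)
    (hx : Summable fun i => x i ^ 2)
    (h : ∑' i, ENNReal.ofReal (|lam i| ^ (1 + a)) * ENNReal.ofReal (min (|x i| ^ p) 1) ≠ ⊤) :
    Summable fun i => |lam i| ^ a * min (|x i| ^ p) 1 := by
  have hm : ∀ i, 0 ≤ min (|x i| ^ p) 1 := fun i => by positivity
  have hs : Summable fun i => |lam i| ^ (1 + a) * min (|x i| ^ p) 1 := by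
    refine (ENNReal.summable_toReal h).congr fun i => ?_
    rw [ENNReal.toReal_mul, ENNReal.toReal_ofReal (by positivity), ENNReal.toReal_ofReal (hm i)]
  refine Summable.of_nonneg_of_le (fun i => mul_nonneg (by positivity) (hm i)) (fun i => ?_)
    (hx.add hs)
  rcases le_total (|lam i|) 1 with hl | hl
  · have hmin : min (|x i| ^ p) 1 ≤ x i ^ 2 := by
      rcases le_total (|x i|) 1 with h1 | h1
      · refine (min_le_left _ _).trans ?_
        rw [← sq_abs, ← Real.rpow_two]
        exact Real.rpow_le_rpow_of_exponent_ge_of_imp (abs_nonneg _) h1 hp (by intro _ h2; linarith)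
      · refine (min_le_right _ _).trans ?_
        rw [← sq_abs]
        exact one_le_pow₀ h1
    have h2 : |lam i| ^ a * min (|x i| ^ p) 1 ≤ min (|x i| ^ p) 1 :=
      mul_le_of_le_one_left (hm i) (Real.rpow_le_one (abs_nonneg _) hl ha.le)
    have h3 : 0 ≤ |lam i| ^ (1 + a) * min (|x i| ^ p) 1 := mul_nonneg (by positivity) (hm i)
    linarith
  · have h2 : |lam i| ^ a * min (|x i| ^ p) 1 ≤ |lam i| ^ (1 + a) * min (|x i| ^ p) 1 :=
      mul_le_mul_of_nonneg_right (Real.rpow_le_rpow_of_exponent_le hl (by linarith)) (hm i)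
    nlinarith [sq_nonneg (x i)]

theorem stmt12
    {H : Type*} [NormedAddCommGroup H] [InnerProductSpace ℝ H] [CompleteSpace H]
    [SecondCountableTopology H] [MeasurableSpace H] [BorelSpace H]
    (b : HilbertBasis ℕ ℝ H)
    (lam : ℕ → ℝ) (hlamne : ∀ i, lam i ≠ 0)
    (p a q : ℝ) (hp : 2 ≤ p) (ha : 0 < a) (hq : 0 < q)
    (μ : ℝ → Measure H) [∀ t, IsProbabilityMeasure (μ t)]
    (hμw : ∀ f : H → ℝ, Continuous f → (∃ C, ∀ x, |f x| ≤ C) →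
      ContinuousOn (fun t => ∫ y, f y ∂ μ t) (Set.Ioi (0 : ℝ)))
    (hc1 : (∑' i : ℕ, ENNReal.ofReal (|lam i| ^ (1 + a)) *
      ∫⁻ t in Set.Ioi (0 : ℝ), ENNReal.ofReal (Real.exp (-(q * t))) *
        ∫⁻ y, ENNReal.ofReal (min (|⟪y, b i⟫| ^ p) 1) ∂ μ t) ≠ ⊤) :
    ∀ᵐ t ∂(volume.restrict (Set.Ioi (0 : ℝ))),
      μ t {y : H | ¬ Summable fun i => |lam i| ^ a * min (|⟪y, b i⟫| ^ p) 1} = 0 := by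
  have hcont : ∀ i, Continuous fun y : H => min (|⟪y, b i⟫| ^ p) 1 := fun i =>
    (((continuous_id.inner continuous_const).abs).rpow_const
      fun _ => Or.inr (by linarith)).min continuous_const
  have hG : ∀ i, AEMeasurable (fun t => ENNReal.ofReal (Real.exp (-(q * t))) *
      ∫⁻ y, ENNReal.ofReal (min (|⟪y, b i⟫| ^ p) 1) ∂ μ t) (volume.restrict (Set.Ioi (0 : ℝ))) :=
    fun i => AEMeasurable.mul (by fun_prop)
      (aemeasurable_lintegral_ofReal_of_weaklyContinuousOn measurableSet_Ioi μ hμw (hcont i)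
        (fun y => by positivity) fun y => min_le_right _ _)
  have hφ : ∀ i, Measurable fun y : H => ENNReal.ofReal (min (|⟪y, b i⟫| ^ p) 1) :=
    fun i => (hcont i).measurable.ennreal_ofReal
  simp_rw [← lintegral_const_mul'' _ (hG _)] at hc1
  rw [← lintegral_tsum fun i => (hG i).const_mul _] at hc1
  have hfin := ae_lt_top' (AEMeasurable.tsum fun i => (hG i).const_mul _) hc1
  filter_upwards [hfin] with t ht
  have hexp : ENNReal.ofReal (Real.exp (-(q * t))) ≠ 0 := by
    simpa using Real.exp_pos _
  simp_rw [mul_left_comm _ (ENNReal.ofReal (Real.exp (-(q * t))))] at ht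
  rw [ENNReal.tsum_mul_left] at ht
  have hsum := ENNReal.lt_top_of_mul_ne_top_right ht.ne hexp
  simp_rw [← lintegral_const_mul _ (hφ _)] at hsum
  rw [← lintegral_tsum fun i => ((hφ i).const_mul _).aemeasurable] at hsum
  have hae := ae_lt_top (Measurable.tsum fun i => (hφ i).const_mul _) hsum.ne
  rw [← ae_iff]
  filter_upwards [hae] with y hy
  have hsq : Summable fun i => ⟪y, b i⟫ ^ 2 := by
    refine (b.summable_inner_mul_inner y y).congr fun i => ?_
    rw [real_inner_comm y (b i), sq]
  exact summable_rpow_mul_min_of_tsum_ne_top hp ha hsq hy.ne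
end

section
/- Under assumption (H_{A,μ}) and with the choice of weights (γ_i), the Lyapunov function V is norm-like: lim_{‖x‖→∞} V(x) = ∞; that is, for every R > 0 there exists ρ > 0 such that ‖x‖ ≥ ρ implies V(x) ≥ R. Consequently each sublevel set {x ∈ H : V(x) ≤ n} is norm-bounded and hence relatively compact in the weak topology of H. -/
open MeasureTheory Filter
open scoped ENNReal Topology RealInnerProductSpace

/-- Along a family of probability measures that is weakly continuous on `[0, ∞)`, integrals of
nonnegative continuous functions depend measurably on the parameter. -/
theorem aemeasurable_lintegral_of_weakly_continuous
    {H : Type*} [TopologicalSpace H] [MeasurableSpace H] [BorelSpace H]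
    (μ : ℝ → Measure H) [∀ t, IsProbabilityMeasure (μ t)]
    (hμw : ∀ f : H → ℝ, Continuous f → (∃ C, ∀ x, |f x| ≤ C) →
      ContinuousOn (fun t => ∫ y, f y ∂ μ t) (Set.Ici (0 : ℝ)))
    {f : H → ℝ} (hf : Continuous f) (hf0 : ∀ y, 0 ≤ f y) :
    AEMeasurable (fun t => ∫⁻ y, ENNReal.ofReal (f y) ∂ μ t)
      (volume.restrict (Set.Ioi (0 : ℝ))) := by
  have hsup : ∀ y, ENNReal.ofReal (f y) = ⨆ n : ℕ, ENNReal.ofReal (min (f y) n) := by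
    intro y
    refine le_antisymm ?_ (iSup_le fun n => ENNReal.ofReal_le_ofReal (min_le_left _ _))
    obtain ⟨n, hn⟩ := exists_nat_ge (f y)
    exact le_iSup_of_le n (by rw [min_eq_left hn])
  have hcont : ∀ n : ℕ, Continuous fun y => min (f y) (n : ℝ) := fun n => hf.min continuous_const
  have hnn : ∀ (n : ℕ) y, 0 ≤ min (f y) (n : ℝ) := fun n y => le_min (hf0 y) n.cast_nonneg
  have hle : ∀ (n : ℕ) y, |min (f y) (n : ℝ)| ≤ n := fun n y => by
    rw [abs_of_nonneg (hnn n y)]; exact min_le_right _ _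
  have hrw : ∀ t, ∫⁻ y, ENNReal.ofReal (f y) ∂ μ t
      = ⨆ n : ℕ, ENNReal.ofReal (∫ y, min (f y) n ∂ μ t) := by
    intro t
    simp_rw [hsup]
    rw [lintegral_iSup (fun n => (hcont n).measurable.ennreal_ofReal)]
    · congr 1
      ext n
      rw [ofReal_integral_eq_lintegral_ofReal _ (ae_of_all _ (hnn n))]
      exact Integrable.of_bound (hcont n).measurable.aestronglyMeasurable n
        (ae_of_all _ (hle n))
    · intro m n hmn y
      exact ENNReal.ofReal_le_ofReal (min_le_min_left _ (by exact_mod_cast hmn))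
  simp_rw [hrw]
  refine AEMeasurable.iSup fun n => AEMeasurable.ennreal_ofReal ?_
  exact ((hμw _ (hcont n) ⟨n, hle n⟩).mono Set.Ioi_subset_Ici_self).aemeasurable measurableSet_Ioi

/-- Pointwise comparison for a doubling function of the modulus. -/
theorem doubling_le_add {ψ : ℝ → ℝ} {K : ℝ} (hψ0 : ∀ s, 0 ≤ s → 0 ≤ ψ s)
    (hmono : MonotoneOn ψ (Set.Ici 0)) (hK : 0 ≤ K) (hdouble : ∀ s, 0 ≤ s → ψ (2 * s) ≤ K * ψ s)
    (u y : ℝ) : ψ |u| ≤ K * (ψ |u + y| + ψ |y|) := by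
  have h : |u| ≤ |u + y| + |y| := by simpa using abs_sub (u + y) y
  have h1 := hψ0 _ (abs_nonneg (u + y))
  have h2 := hψ0 _ (abs_nonneg y)
  rcases le_total |u + y| |y| with h' | h'
  · calc ψ |u| ≤ ψ (2 * |y|) :=
          hmono (abs_nonneg u) (by simp [Set.mem_Ici]) (by linarith)
      _ ≤ K * ψ |y| := hdouble _ (abs_nonneg _)
      _ ≤ _ := by gcongr; linarith
  · calc ψ |u| ≤ ψ (2 * |u + y|) :=
          hmono (abs_nonneg u) (by simp [Set.mem_Ici]) (by linarith)
      _ ≤ K * ψ |u + y| := hdouble _ (abs_nonneg _)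
      _ ≤ _ := by gcongr; linarith

/-- On a time interval of length `|l|⁻¹` the factor `exp (l * t)` costs at most two doublings. -/
theorem doubling_le_exp_mul {ψ : ℝ → ℝ} {K : ℝ}
    (hmono : MonotoneOn ψ (Set.Ici 0)) (hK : 0 ≤ K) (hdouble : ∀ s, 0 ≤ s → ψ (2 * s) ≤ K * ψ s)
    {l t : ℝ} (hl : l ≠ 0) (ht0 : 0 ≤ t) (ht : t ≤ |l|⁻¹) (u : ℝ) :
    ψ |u| ≤ K ^ 2 * ψ |Real.exp (l * t) * u| := by
  have hlt : -1 ≤ l * t := by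
    have h1 : |l| * t ≤ 1 := by
      calc |l| * t ≤ |l| * |l|⁻¹ := by gcongr
        _ = 1 := mul_inv_cancel₀ (abs_ne_zero.mpr hl)
    have h2 : |l * t| ≤ 1 := by rwa [abs_mul, abs_of_nonneg ht0]
    exact (abs_le.mp h2).1
  have hexp : 1 ≤ 4 * Real.exp (l * t) := by
    have h1 : Real.exp (-1) ≤ Real.exp (l * t) := Real.exp_le_exp.mpr hlt
    have h2 : Real.exp (-1) * Real.exp 1 = 1 := by rw [← Real.exp_add]; simp
    nlinarith [Real.exp_one_lt_d9, Real.exp_pos (-1)]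
  have habs : |Real.exp (l * t) * u| = Real.exp (l * t) * |u| := by
    rw [abs_mul, abs_of_pos (Real.exp_pos _)]
  have hs := abs_nonneg (Real.exp (l * t) * u)
  calc ψ |u| ≤ ψ (2 * (2 * |Real.exp (l * t) * u|)) := by
        refine hmono (abs_nonneg u) (Set.mem_Ici.mpr (by positivity)) ?_
        rw [habs]
        nlinarith [abs_nonneg u]
    _ ≤ K * ψ (2 * |Real.exp (l * t) * u|) := hdouble _ (by positivity)
    _ ≤ K * (K * ψ |Real.exp (l * t) * u|) := by gcongr; exact hdouble _ hs
    _ = _ := by ring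

/-- The discounted potential of a weighted sum of a doubling function of the coordinates dominates,
up to the contribution of the noise alone, the same sum with weights divided by `|lam i|`. -/
theorem exists_tsum_le_potential
    {H : Type*} [NormedAddCommGroup H] [InnerProductSpace ℝ H]
    [MeasurableSpace H] [BorelSpace H]
    (e : ℕ → H) {lam : ℕ → ℝ} (hlamne : ∀ i, lam i ≠ 0) (hlamtop : Tendsto lam atTop atBot)
    (T : ℝ → H →L[ℝ] H)
    (hTeig : ∀ t : ℝ, 0 ≤ t → ∀ (x : H) (i : ℕ),
      ⟪T t x, e i⟫ = Real.exp (lam i * t) * ⟪x, e i⟫)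
    (μ : ℝ → Measure H) [∀ t, IsProbabilityMeasure (μ t)]
    (hμw : ∀ f : H → ℝ, Continuous f → (∃ C, ∀ x, |f x| ≤ C) →
      ContinuousOn (fun t => ∫ y, f y ∂ μ t) (Set.Ici (0 : ℝ)))
    (q : ℝ) {ψ : ℝ → ℝ} {K : ℝ} (hψc : Continuous ψ) (hψ0 : ∀ s, 0 ≤ s → 0 ≤ ψ s)
    (hmono : MonotoneOn ψ (Set.Ici 0)) (hK : 0 ≤ K) (hdouble : ∀ s, 0 ≤ s → ψ (2 * s) ≤ K * ψ s)
    {w : ℕ → ℝ} (hw : ∀ i, 0 ≤ w i) :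
    ∃ C : ℝ, ∀ x : H, ∑' i, ENNReal.ofReal (w i * |lam i|⁻¹ * ψ |⟪x, e i⟫|) ≤ ENNReal.ofReal C *
      ((∫⁻ t in Set.Ioi (0 : ℝ), ENNReal.ofReal (Real.exp (-(q * t))) *
          ∫⁻ y, ∑' i, ENNReal.ofReal (w i * ψ |⟪T t x + y, e i⟫|) ∂ μ t) +
        ∑' i, ENNReal.ofReal (w i) *
          ∫⁻ t in Set.Ioi (0 : ℝ), ENNReal.ofReal (Real.exp (-(q * t))) *
            ∫⁻ y, ENNReal.ofReal (ψ |⟪y, e i⟫|) ∂ μ t) := by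
  obtain ⟨B, hB⟩ : ∃ B, ∀ i, |lam i|⁻¹ ≤ B := by
    have h : Tendsto (fun i => |lam i|⁻¹) atTop (𝓝 0) :=
      tendsto_inv_atTop_zero.comp (tendsto_abs_atBot_atTop.comp hlamtop)
    obtain ⟨B, hB⟩ := h.bddAbove_range
    exact ⟨B, fun i => hB ⟨i, rfl⟩⟩
  have hcm : ∀ i, Continuous fun y : H => ψ |⟪y, e i⟫| := fun i =>
    hψc.comp (continuous_abs.comp (continuous_id.inner continuous_const))
  have hE : Measurable fun t : ℝ => ENNReal.ofReal (Real.exp (-(q * t))) := by fun_prop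
  have hG : ∀ i, AEMeasurable (fun t => ENNReal.ofReal (w i) *
      (ENNReal.ofReal (Real.exp (-(q * t))) * ∫⁻ y, ENNReal.ofReal (ψ |⟪y, e i⟫|) ∂ μ t))
      (volume.restrict (Set.Ioi (0 : ℝ))) := fun i =>
    (hE.aemeasurable.mul (aemeasurable_lintegral_of_weakly_continuous μ hμw (hcm i)
      fun y => hψ0 _ (abs_nonneg _))).const_mul _
  refine ⟨Real.exp (|q| * B) * K ^ 3, fun x => ?_⟩
  set D : ℝ := Real.exp (|q| * B) * K ^ 3
  have hD : 0 ≤ D := by positivity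
  have key : ∀ i, ∀ t ∈ Set.Ioi (0 : ℝ),
      (Set.Ioc (0 : ℝ) |lam i|⁻¹).indicator
        (fun _ => ENNReal.ofReal (w i * ψ |⟪x, e i⟫|)) t ≤
      ENNReal.ofReal D * (ENNReal.ofReal (Real.exp (-(q * t))) *
          ∫⁻ y, ENNReal.ofReal (w i * ψ |⟪T t x + y, e i⟫|) ∂ μ t
        + ENNReal.ofReal (w i) * (ENNReal.ofReal (Real.exp (-(q * t))) *
            ∫⁻ y, ENNReal.ofReal (ψ |⟪y, e i⟫|) ∂ μ t)) := by
    intro i t ht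
    have ht0 : 0 < t := ht
    by_cases htl : t ∈ Set.Ioc (0 : ℝ) |lam i|⁻¹
    swap
    · rw [Set.indicator_of_notMem htl]; exact zero_le
    rw [Set.indicator_of_mem htl]
    have hfactor : 1 ≤ Real.exp (|q| * B) * Real.exp (-(q * t)) := by
      rw [← Real.exp_add, Real.one_le_exp_iff]
      have h1 : q * t ≤ |q| * t := mul_le_mul_of_nonneg_right (le_abs_self q) ht0.le
      have h2 : |q| * t ≤ |q| * B := by gcongr; exact htl.2.trans (hB i)
      linarith
    have hpt : ∀ y : H, w i * ψ |⟪x, e i⟫| ≤ D * (Real.exp (-(q * t)) *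
        (w i * ψ |⟪T t x + y, e i⟫|) + w i * (Real.exp (-(q * t)) * ψ |⟪y, e i⟫|)) := by
      intro y
      have h1 := doubling_le_exp_mul hmono hK hdouble (hlamne i) ht0.le htl.2 ⟪x, e i⟫
      have h2 := doubling_le_add hψ0 hmono hK hdouble (Real.exp (lam i * t) * ⟪x, e i⟫) ⟪y, e i⟫
      rw [inner_add_left, hTeig t ht0.le]
      set P := ψ |Real.exp (lam i * t) * ⟪x, e i⟫ + ⟪y, e i⟫|
      set Q := ψ |⟪y, e i⟫|
      have hP : 0 ≤ P := hψ0 _ (abs_nonneg _)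
      have hQ : 0 ≤ Q := hψ0 _ (abs_nonneg _)
      have hwi := hw i
      calc w i * ψ |⟪x, e i⟫| ≤ w i * (K ^ 2 * (K * (P + Q))) := by
            gcongr
            exact h1.trans (by gcongr)
        _ = 1 * (w i * (K ^ 3 * (P + Q))) := by ring
        _ ≤ (Real.exp (|q| * B) * Real.exp (-(q * t))) * (w i * (K ^ 3 * (P + Q))) := by gcongr
        _ = _ := by simp only [D]; ring
    have hm1 : Measurable fun y : H => ENNReal.ofReal (w i * ψ |⟪T t x + y, e i⟫|) :=
      (((hcm i).comp (continuous_const.add continuous_id)).const_mul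
        (w i)).measurable.ennreal_ofReal
    have hm2 : Measurable fun y : H => ENNReal.ofReal (ψ |⟪y, e i⟫|) :=
      (hcm i).measurable.ennreal_ofReal
    rw [← lintegral_const_mul _ hm1, ← lintegral_const_mul _ hm2,
      ← lintegral_const_mul _ (hm2.const_mul _), ← lintegral_add_left (hm1.const_mul _),
      ← lintegral_const_mul' _ _ ENNReal.ofReal_ne_top]
    calc ENNReal.ofReal (w i * ψ |⟪x, e i⟫|)
        = ∫⁻ _, ENNReal.ofReal (w i * ψ |⟪x, e i⟫|) ∂ μ t := by simp
      _ ≤ _ := by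
        refine lintegral_mono fun y => ?_
        have hP : 0 ≤ ψ |⟪T t x + y, e i⟫| := hψ0 _ (abs_nonneg _)
        have hQ : 0 ≤ ψ |⟪y, e i⟫| := hψ0 _ (abs_nonneg _)
        have hwi := hw i
        refine (ENNReal.ofReal_le_ofReal (hpt y)).trans_eq ?_
        rw [ENNReal.ofReal_mul hD, ENNReal.ofReal_add (by positivity) (by positivity),
          ENNReal.ofReal_mul (q := w i * ψ |⟪T t x + y, e i⟫|) (Real.exp_pos _).le,
          ENNReal.ofReal_mul (q := Real.exp (-(q * t)) * ψ |⟪y, e i⟫|) hwi,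
          ENNReal.ofReal_mul (q := ψ |⟪y, e i⟫|) (Real.exp_pos _).le]
  calc ∑' i, ENNReal.ofReal (w i * |lam i|⁻¹ * ψ |⟪x, e i⟫|)
      = ∑' i, ∫⁻ t in Set.Ioi (0 : ℝ), (Set.Ioc (0 : ℝ) |lam i|⁻¹).indicator
        (fun _ => ENNReal.ofReal (w i * ψ |⟪x, e i⟫|)) t := by
        congr 1
        ext i
        have hsub : Set.Ioc (0 : ℝ) |lam i|⁻¹ ∩ Set.Ioi 0 = Set.Ioc (0 : ℝ) |lam i|⁻¹ :=
          Set.inter_eq_left.mpr fun t ht => ht.1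
        rw [lintegral_indicator_const measurableSet_Ioc, Measure.restrict_apply measurableSet_Ioc,
          hsub, Real.volume_Ioc, sub_zero, ← ENNReal.ofReal_mul
            (mul_nonneg (hw i) (hψ0 _ (abs_nonneg _)))]
        congr 1
        ring
    _ = ∫⁻ t in Set.Ioi (0 : ℝ), ∑' i, (Set.Ioc (0 : ℝ) |lam i|⁻¹).indicator
        (fun _ => ENNReal.ofReal (w i * ψ |⟪x, e i⟫|)) t :=
        (lintegral_tsum fun i => (measurable_const.indicator measurableSet_Ioc).aemeasurable).symm
    _ ≤ ∫⁻ t in Set.Ioi (0 : ℝ), ENNReal.ofReal D *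
        (ENNReal.ofReal (Real.exp (-(q * t))) *
          (∫⁻ y, ∑' i, ENNReal.ofReal (w i * ψ |⟪T t x + y, e i⟫|) ∂ μ t)
        + ∑' i, ENNReal.ofReal (w i) * (ENNReal.ofReal (Real.exp (-(q * t))) *
            ∫⁻ y, ENNReal.ofReal (ψ |⟪y, e i⟫|) ∂ μ t)) := by
        refine setLIntegral_mono' measurableSet_Ioi fun t ht => ?_
        refine (ENNReal.tsum_le_tsum fun i => key i t ht).trans_eq ?_
        rw [ENNReal.tsum_mul_left, ENNReal.tsum_add, ENNReal.tsum_mul_left, lintegral_tsum]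
        exact fun i => (((hcm i).comp (continuous_const.add continuous_id)).const_mul
          (w i)).measurable.ennreal_ofReal.aemeasurable
    _ = _ := by
        rw [lintegral_const_mul' _ _ ENNReal.ofReal_ne_top,
          lintegral_add_right' _ (AEMeasurable.tsum hG), lintegral_tsum hG]
        simp_rw [lintegral_const_mul' _ _ ENNReal.ofReal_ne_top]

/-- A weighted truncated `p`-th power controls the squares of the coordinates that are at most `1`,
up to a fixed summable sequence. -/
theorem sq_le_rpow_add_rpow {p a l s : ℝ} (hp : 2 < p) (hl : 0 < l) (hs0 : 0 ≤ s) :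
    s ^ 2 ≤ l ^ a * s ^ p + l ^ (-(2 * a / (p - 2))) := by
  have hla : 0 < l ^ a := Real.rpow_pos_of_pos hl a
  have h1 : 0 ≤ l ^ a * s ^ p := mul_nonneg hla.le (Real.rpow_nonneg hs0 p)
  have h2 : 0 ≤ l ^ (-(2 * a / (p - 2))) := Real.rpow_nonneg hl.le _
  rcases hs0.eq_or_lt with rfl | hs
  · nlinarith
  by_cases hc : 1 ≤ l ^ a * s ^ (p - 2)
  · have : s ^ 2 ≤ l ^ a * s ^ p := by
      calc s ^ 2 = 1 * s ^ 2 := (one_mul _).symm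
        _ ≤ l ^ a * s ^ (p - 2) * s ^ 2 := by gcongr
        _ = l ^ a * s ^ p := by
          rw [mul_assoc, ← Real.rpow_natCast s 2, ← Real.rpow_add hs]; norm_num
    linarith
  · push Not at hc
    have hp2 : 0 < p - 2 := by linarith
    have h3 : s ^ (p - 2) ≤ l ^ (-a) := by
      rw [Real.rpow_neg hl.le, ← one_div, le_div_iff₀ hla]; linarith
    have h4 : s ^ 2 ≤ l ^ (-(2 * a / (p - 2))) := by
      calc s ^ 2 = (s ^ (p - 2)) ^ (2 / (p - 2)) := by
            rw [← Real.rpow_mul hs.le, ← Real.rpow_natCast s 2]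
            congr 1
            field_simp
            norm_num
        _ ≤ (l ^ (-a)) ^ (2 / (p - 2)) :=
            Real.rpow_le_rpow (Real.rpow_nonneg hs.le _) h3 (by positivity)
        _ = _ := by
            rw [← Real.rpow_mul hl.le]
            congr 1
            ring
    linarith

/-- Bounds on the two weighted coordinate sums bound the norm. -/
theorem exists_norm_bound_of_tsum_le
    {H : Type*} [NormedAddCommGroup H] [InnerProductSpace ℝ H]
    (b : HilbertBasis ℕ ℝ H) {lam : ℕ → ℝ} (hlamne : ∀ i, lam i ≠ 0)
    (hlamtop : Tendsto lam atTop atBot) {p a γ : ℝ} (hp : 2 < p) (ha : 0 < a)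
    (hsum2 : Summable fun i => |lam i| ^ (-(2 * a / (p - 2))))
    (hγ0 : 0 < γ) {g : ℕ → ℝ} (hg0 : ∀ i, 0 < g i) (M₁ M₂ : ℝ≥0∞) (h₁ : M₁ ≠ ⊤) (h₂ : M₂ ≠ ⊤) :
    ∃ ρ : ℝ, ∀ x : H,
      ∑' i, ENNReal.ofReal (|lam i| ^ (1 + a) * |lam i|⁻¹ * min (|⟪x, b i⟫| ^ p) 1) ≤ M₁ →
      ∑' i, ENNReal.ofReal (g i * |lam i|⁻¹ * |⟪x, b i⟫| ^ γ) ≤ M₂ → ‖x‖ ≤ ρ := by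
  obtain ⟨N, hN⟩ : ∃ N, ∀ i ≥ N, M₁.toReal < |lam i| ^ a :=
    eventually_atTop.mp (((tendsto_rpow_atTop ha).comp
      (tendsto_abs_atBot_atTop.comp hlamtop)).eventually_gt_atTop _)
  have hl : ∀ i, 0 < |lam i| := fun i => abs_pos.mpr (hlamne i)
  set big : ℕ → ℝ := fun i => (M₂.toReal * |lam i| / g i) ^ γ⁻¹
  set S : ℝ≥0∞ := M₁ + ∑' i, ENNReal.ofReal (|lam i| ^ (-(2 * a / (p - 2))))
    + ∑ i ∈ Finset.range N, ENNReal.ofReal (big i ^ 2) with hS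
  have hStop : S ≠ ⊤ := by
    refine ENNReal.add_ne_top.mpr ⟨ENNReal.add_ne_top.mpr ⟨h₁, hsum2.tsum_ofReal_ne_top⟩, ?_⟩
    exact ENNReal.sum_ne_top.mpr fun i _ => ENNReal.ofReal_ne_top
  refine ⟨√S.toReal, fun x hx₁ hx₂ => Real.le_sqrt_of_sq_le ?_⟩
  have hcoef : ∀ i, |lam i| ^ (1 + a) * |lam i|⁻¹ = |lam i| ^ a := fun i => by
    rw [Real.rpow_add (hl i), Real.rpow_one]
    field_simp [(hl i).ne']
  simp_rw [hcoef] at hx₁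
  have hpoint : ∀ i, ENNReal.ofReal (⟪x, b i⟫ ^ 2) ≤
      ENNReal.ofReal (|lam i| ^ a * min (|⟪x, b i⟫| ^ p) 1)
        + ENNReal.ofReal (|lam i| ^ (-(2 * a / (p - 2))))
        + (if i ∈ Finset.range N then ENNReal.ofReal (big i ^ 2) else 0) := by
    intro i
    rw [← sq_abs]
    rcases le_or_gt |⟪x, b i⟫| 1 with hi | hi
    · refine le_add_right ?_
      have hle : |⟪x, b i⟫| ^ p ≤ 1 := Real.rpow_le_one (abs_nonneg _) hi (by linarith)
      rw [min_eq_left hle, ← ENNReal.ofReal_add (by positivity) (by positivity)]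
      exact ENNReal.ofReal_le_ofReal (sq_le_rpow_add_rpow hp (hl i) (abs_nonneg _))
    · have hiN : i ∈ Finset.range N := by
        rw [Finset.mem_range]
        by_contra hcon
        have h := (ENNReal.le_tsum i).trans hx₁
        rw [min_eq_right (Real.one_le_rpow hi.le (by linarith)), mul_one,
          ENNReal.ofReal_le_iff_le_toReal h₁] at h
        exact absurd (hN i (not_lt.mp hcon)) (not_lt.mpr h)
      rw [if_pos hiN]
      refine le_add_left (ENNReal.ofReal_le_ofReal ?_)
      have h := (ENNReal.le_tsum i).trans hx₂
      rw [ENNReal.ofReal_le_iff_le_toReal h₂] at h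
      have hpow : |⟪x, b i⟫| ^ γ ≤ M₂.toReal * |lam i| / g i := by
        rw [le_div_iff₀ (hg0 i)]
        calc |⟪x, b i⟫| ^ γ * g i = g i * |lam i|⁻¹ * |⟪x, b i⟫| ^ γ * |lam i| := by
              field_simp [(hl i).ne']
          _ ≤ _ := by gcongr
      have habs : |⟪x, b i⟫| ≤ big i := by
        calc |⟪x, b i⟫| = (|⟪x, b i⟫| ^ γ) ^ γ⁻¹ := (Real.rpow_rpow_inv (abs_nonneg _) hγ0.ne').symm
          _ ≤ _ := Real.rpow_le_rpow (by positivity) hpow (by positivity)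
      gcongr
  have hnorm : ENNReal.ofReal (‖x‖ ^ 2) = ∑' i, ENNReal.ofReal (⟪x, b i⟫ ^ 2) := by
    have h := b.hasSum_inner_mul_inner x x
    have h' : HasSum (fun i => ⟪x, b i⟫ ^ 2) (‖x‖ ^ 2) := by
      rw [real_inner_self_eq_norm_sq] at h
      refine h.congr_fun ?_
      intro i
      rw [real_inner_comm x (b i), sq]
    rw [← h'.tsum_eq, ENNReal.ofReal_tsum_of_nonneg (fun i => sq_nonneg _) h'.summable]
  rw [← ENNReal.ofReal_le_iff_le_toReal hStop, hnorm]
  calc _ ≤ _ := ENNReal.tsum_le_tsum hpoint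
    _ ≤ S := by
      rw [ENNReal.tsum_add, ENNReal.tsum_add, hS]
      gcongr
      rw [tsum_eq_sum (s := Finset.range N) fun i hi => if_neg hi]
      exact Finset.sum_le_sum fun i hi => by rw [if_pos hi]

theorem stmt13
    {H : Type*} [NormedAddCommGroup H] [InnerProductSpace ℝ H] [CompleteSpace H]
    [SecondCountableTopology H] [MeasurableSpace H] [BorelSpace H]
    (b : HilbertBasis ℕ ℝ H)
    (lam : ℕ → ℝ) (hlamne : ∀ i, lam i ≠ 0) (hlamanti : Antitone lam)
    (hlamtop : Tendsto lam atTop atBot)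
    (T : ℝ → H →L[ℝ] H)
    (hT0 : T 0 = ContinuousLinearMap.id ℝ H)
    (hTsg : ∀ s t : ℝ, 0 ≤ s → 0 ≤ t → T (t + s) = (T t).comp (T s))
    (hTcont : ∀ x : H, ContinuousOn (fun t => T t x) (Set.Ici (0 : ℝ)))
    (hTeig : ∀ t : ℝ, 0 ≤ t → ∀ (x : H) (i : ℕ),
      ⟪T t x, b i⟫ = Real.exp (lam i * t) * ⟪x, b i⟫)
    (μ : ℝ → Measure H) [∀ t, IsProbabilityMeasure (μ t)]
    (hμ0 : μ 0 = Measure.dirac 0)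
    (hμw : ∀ f : H → ℝ, Continuous f → (∃ C, ∀ x, |f x| ≤ C) →
      ContinuousOn (fun t => ∫ y, f y ∂ μ t) (Set.Ici (0 : ℝ)))
    (hμconv : ∀ s t : ℝ, 0 ≤ s → 0 ≤ t →
      μ (t + s) = Measure.map (fun yz : H × H => yz.1 + yz.2)
        (((μ t).map (T s)).prod (μ s)))
    (p a q γ : ℝ) (hp : 2 < p) (ha : 0 < a) (hq : p * lam 0 < q)
    (hγ0 : 0 < γ) (hγ1 : γ ≤ 1)
    (c1 : ℝ≥0∞)
    (hc1def : c1 = ∑' i : ℕ, ENNReal.ofReal (|lam i| ^ (1 + a)) *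
      ∫⁻ t in Set.Ioi (0 : ℝ), ENNReal.ofReal (Real.exp (-(q * t))) *
        ∫⁻ y, ENNReal.ofReal (min (|⟪y, b i⟫| ^ p) 1) ∂ μ t)
    (hc1 : c1 ≠ ⊤)
    (hsum1 : ∀ t : ℝ, 0 < t → Summable fun i => |lam i| ^ a * Real.exp (p * lam i * t))
    (hsum2 : Summable fun i => |lam i| ^ (-(2 * a / (p - 2))))
    (hmom : ∀ i : ℕ, (∫⁻ t in Set.Ioi (0 : ℝ), ENNReal.ofReal (Real.exp (-(q * t))) *
        ∫⁻ y, ENNReal.ofReal (|⟪y, b i⟫| ^ γ) ∂ μ t) ≠ ⊤)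
    (g : ℕ → ℝ) (hg0 : ∀ i, 0 < g i) (hg1 : ∀ i, g i ≤ 1) (hganti : Antitone g)
    (hgsum : Summable fun i => g i ^ (2 / (2 - γ)))
    (c2 : ℝ≥0∞)
    (hc2def : c2 = ∑' i : ℕ, ENNReal.ofReal (g i) *
      ∫⁻ t in Set.Ioi (0 : ℝ), ENNReal.ofReal (Real.exp (-(q * t))) *
        ∫⁻ y, ENNReal.ofReal (|⟪y, b i⟫| ^ γ) ∂ μ t)
    (hc2 : c2 ≠ ⊤)
    (v : H → ℝ≥0∞)
    (hvdef : ∀ x : H, v x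
      = (∑' i : ℕ, ENNReal.ofReal (|lam i| ^ (1 + a) * min (|⟪x, b i⟫| ^ p) 1))
        + ∑' i : ℕ, ENNReal.ofReal (g i * |⟪x, b i⟫| ^ γ))
    (V : H → ℝ≥0∞)
    (hVdef : ∀ x : H, V x = ∫⁻ t in Set.Ioi (0 : ℝ),
      ENNReal.ofReal (Real.exp (-(q * t))) * ∫⁻ y, v (T t x + y) ∂ μ t)
    (H0 : Set H)
    (hH0 : H0 = {x : H | Summable fun i => |lam i| ^ a * |⟪x, b i⟫| ^ p})
    :
    (∀ R : ℝ, 0 < R → ∃ ρ : ℝ, 0 < ρ ∧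
      ∀ x : H, ρ ≤ ‖x‖ → ENNReal.ofReal R ≤ V x) ∧
    (∀ n : ℕ, ∃ R : ℝ, ∀ x : H, V x ≤ (n : ℝ≥0∞) → ‖x‖ ≤ R) := by
  have hp0 : 0 < p := by linarith
  have hVge : ∀ x (u : H → ℝ≥0∞), (∀ z, u z ≤ v z) →
      (∫⁻ t in Set.Ioi (0 : ℝ), ENNReal.ofReal (Real.exp (-(q * t))) *
        ∫⁻ y, u (T t x + y) ∂ μ t) ≤ V x := by
    intro x u hu
    rw [hVdef]
    gcongr
    exact hu _
  obtain ⟨C₁, hC₁⟩ := exists_tsum_le_potential (fun i => b i) hlamne hlamtop T hTeig μ hμw q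
    (ψ := fun s => min (s ^ p) 1) (K := 2 ^ p) (w := fun i => |lam i| ^ (1 + a))
    ((Real.continuous_rpow_const hp0.le).min continuous_const)
    (fun s hs => le_min (Real.rpow_nonneg hs p) zero_le_one)
    (fun s hs t _ hst => min_le_min_right _ (Real.rpow_le_rpow hs hst hp0.le))
    (by positivity)
    (fun s hs => by
      have h2 : (1 : ℝ) ≤ 2 ^ p := Real.one_le_rpow one_le_two hp0.le
      rw [Real.mul_rpow zero_le_two hs, mul_min_of_nonneg _ _ (by positivity), mul_one]
      exact min_le_min_left _ h2)
    (fun i => by positivity)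
  obtain ⟨C₂, hC₂⟩ := exists_tsum_le_potential (fun i => b i) hlamne hlamtop T hTeig μ hμw q
    (ψ := fun s => s ^ γ) (K := 2 ^ γ) (w := g)
    (Real.continuous_rpow_const hγ0.le)
    (fun s hs => Real.rpow_nonneg hs γ)
    (fun s hs t _ hst => Real.rpow_le_rpow hs hst hγ0.le)
    (by positivity)
    (fun s hs => (Real.mul_rpow zero_le_two hs).le)
    (fun i => (hg0 i).le)
  have hbound : ∀ R : ℝ≥0∞, R ≠ ⊤ → ∃ ρ : ℝ, ∀ x, V x ≤ R → ‖x‖ ≤ ρ := by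
    intro R hR
    obtain ⟨ρ, hρ⟩ := exists_norm_bound_of_tsum_le b hlamne hlamtop hp ha hsum2 hγ0 hg0
      (ENNReal.ofReal C₁ * (R + c1)) (ENNReal.ofReal C₂ * (R + c2))
      (ENNReal.mul_ne_top ENNReal.ofReal_ne_top (ENNReal.add_ne_top.mpr ⟨hR, hc1⟩))
      (ENNReal.mul_ne_top ENNReal.ofReal_ne_top (ENNReal.add_ne_top.mpr ⟨hR, hc2⟩))
    refine ⟨ρ, fun x hx => hρ x ((hC₁ x).trans ?_) ((hC₂ x).trans ?_)⟩
    · rw [← hc1def]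
      gcongr
      exact (hVge x (fun z => ∑' i, ENNReal.ofReal (|lam i| ^ (1 + a) * min (|⟪z, b i⟫| ^ p) 1))
        fun z => by rw [hvdef]; exact le_self_add).trans hx
    · rw [← hc2def]
      gcongr
      exact (hVge x (fun z => ∑' i, ENNReal.ofReal (g i * |⟪z, b i⟫| ^ γ))
        fun z => by rw [hvdef]; exact le_add_self).trans hx
  refine ⟨fun R _ => ?_, fun n => hbound n (ENNReal.natCast_ne_top n)⟩
  obtain ⟨ρ, hρ⟩ := hbound (ENNReal.ofReal R) ENNReal.ofReal_ne_top
  refine ⟨|ρ| + 1, by positivity, fun x hx => ?_⟩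
  by_contra! hlt
  linarith [hρ x hlt.le, le_abs_self ρ]
end

section
/- For every α > max(0, 2λ_1) and every x ∈ H, the Laplace transform of the squared semigroup deviation is given exactly by ∫_0^∞ α e^{−α t} ‖T_t x − x‖² dt = Σ_{i≥1} ⟨x, e_i⟩² · 2 λ_i² / ((α − 2λ_i)(α − λ_i)), and this sum is finite. -/
open MeasureTheory Filter
open scoped ENNReal Topology RealInnerProductSpace

/-- The Laplace transform of `(exp (l t) - 1) ^ 2`, together with integrability. -/
lemma laplace_exp_sub_one_sq {α l : ℝ} (hα : 0 < α) (hl : 2 * l < α) :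
    IntegrableOn (fun t => α * Real.exp (-(α * t)) * (Real.exp (l * t) - 1) ^ 2)
      (Set.Ioi (0 : ℝ)) ∧
    ∫ t in Set.Ioi (0 : ℝ), α * Real.exp (-(α * t)) * (Real.exp (l * t) - 1) ^ 2
      = 2 * l ^ 2 / ((α - 2 * l) * (α - l)) := by
  have h₁ : 2 * l - α < 0 := by linarith
  have h₂ : l - α < 0 := by linarith
  have h₃ : -α < 0 := by linarith
  have hexpand : (fun t => α * Real.exp (-(α * t)) * (Real.exp (l * t) - 1) ^ 2)
      = fun t => α * Real.exp ((2 * l - α) * t) - 2 * α * Real.exp ((l - α) * t)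
        + α * Real.exp (-α * t) := by
    funext t
    have e₁ : Real.exp ((2 * l - α) * t)
        = Real.exp (-(α * t)) * (Real.exp (l * t) * Real.exp (l * t)) := by
      rw [← Real.exp_add, ← Real.exp_add]; ring_nf
    have e₂ : Real.exp ((l - α) * t) = Real.exp (-(α * t)) * Real.exp (l * t) := by
      rw [← Real.exp_add]; ring_nf
    rw [e₁, e₂, neg_mul]
    ring
  have i₁ := (integrableOn_exp_mul_Ioi h₁ 0).const_mul α
  have i₂ := (integrableOn_exp_mul_Ioi h₂ 0).const_mul (2 * α)
  have i₃ := (integrableOn_exp_mul_Ioi h₃ 0).const_mul α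
  rw [hexpand]
  refine ⟨(i₁.sub i₂).add i₃, ?_⟩
  refine (integral_add (i₁.sub i₂) i₃).trans ?_
  rw [integral_sub' i₁ i₂, integral_const_mul,
    integral_const_mul, integral_const_mul, integral_exp_mul_Ioi h₁, integral_exp_mul_Ioi h₂,
    integral_exp_mul_Ioi h₃]
  simp only [mul_zero, Real.exp_zero]
  have n₁ : α - 2 * l ≠ 0 := by linarith
  have n₂ : α - l ≠ 0 := by linarith
  rw [← neg_sub α (2 * l), ← neg_sub α l]
  simp only [neg_div_neg_eq]
  field_simp
  ring

lemma laplace_coeff_nonneg {α l : ℝ} (hα : 0 < α) (hl : 2 * l < α) :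
    0 ≤ 2 * l ^ 2 / ((α - 2 * l) * (α - l)) := by
  have h₁ : 0 < α - 2 * l := by linarith
  have h₂ : 0 < α - l := by linarith
  positivity

lemma laplace_coeff_le {α l m : ℝ} (hα : 0 < α) (hlm : l ≤ m) (hm : 2 * m < α) :
    2 * l ^ 2 / ((α - 2 * l) * (α - l)) ≤ 1 + 2 * m ^ 2 / ((α - 2 * m) * (α - m)) := by
  have h₁ : 0 < α - 2 * m := by linarith
  have h₂ : 0 < α - m := by linarith
  rcases le_total l 0 with h | h
  · have hle : 2 * l ^ 2 / ((α - 2 * l) * (α - l)) ≤ 1 := by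
      refine div_le_one_of_le₀ ?_ (mul_nonneg (by linarith) (by linarith))
      nlinarith [mul_nonneg hα.le (neg_nonneg.2 h)]
    linarith [laplace_coeff_nonneg hα hm]
  · have hle : 2 * l ^ 2 / ((α - 2 * l) * (α - l)) ≤ 2 * m ^ 2 / ((α - 2 * m) * (α - m)) := by
      have : 0 ≤ α - 2 * l := by linarith
      gcongr
    linarith

lemma HilbertBasis.hasSum_inner_sq {ι H : Type*} [NormedAddCommGroup H] [InnerProductSpace ℝ H]
    (b : HilbertBasis ι ℝ H) (x : H) : HasSum (fun i => ⟪x, b i⟫ ^ 2) (‖x‖ ^ 2) := by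
  have h := b.hasSum_inner_mul_inner x x
  rw [real_inner_self_eq_norm_sq] at h
  refine h.congr_fun fun i => ?_
  rw [real_inner_comm x (b i), sq]

theorem stmt15
    {H : Type*} [NormedAddCommGroup H] [InnerProductSpace ℝ H] [CompleteSpace H]
    [SecondCountableTopology H] [MeasurableSpace H] [BorelSpace H]
    (b : HilbertBasis ℕ ℝ H)
    (lam : ℕ → ℝ) (hlamanti : Antitone lam)
    (T : ℝ → H →L[ℝ] H)
    (hT0 : T 0 = ContinuousLinearMap.id ℝ H)
    (hTsg : ∀ s t : ℝ, 0 ≤ s → 0 ≤ t → T (t + s) = (T t).comp (T s))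
    (hTcont : ∀ x : H, ContinuousOn (fun t => T t x) (Set.Ici (0 : ℝ)))
    (hTeig : ∀ t : ℝ, 0 ≤ t → ∀ (x : H) (i : ℕ),
      ⟪T t x, b i⟫ = Real.exp (lam i * t) * ⟪x, b i⟫) :
    ∀ α : ℝ, max 0 (2 * lam 0) < α → ∀ x : H,
      (Summable fun i =>
        ⟪x, b i⟫ ^ 2 * (2 * lam i ^ 2 / ((α - 2 * lam i) * (α - lam i)))) ∧
      (∫ t in Set.Ioi (0 : ℝ), α * Real.exp (-(α * t)) * ‖T t x - x‖ ^ 2)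
        = ∑' i : ℕ, ⟪x, b i⟫ ^ 2 * (2 * lam i ^ 2 / ((α - 2 * lam i) * (α - lam i))) := by
  intro α hα x
  have hα0 : 0 < α := (le_max_left _ _).trans_lt hα
  have hα1 : 2 * lam 0 < α := (le_max_right _ _).trans_lt hα
  have hle (i : ℕ) : lam i ≤ lam 0 := hlamanti (Nat.zero_le i)
  have hlam (i : ℕ) : 2 * lam i < α := by linarith [hle i]
  have hsum : Summable fun i =>
      ⟪x, b i⟫ ^ 2 * (2 * lam i ^ 2 / ((α - 2 * lam i) * (α - lam i))) :=
    Summable.of_nonneg_of_le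
      (fun i => mul_nonneg (sq_nonneg _) (laplace_coeff_nonneg hα0 (hlam i)))
      (fun i => mul_le_mul_of_nonneg_left (laplace_coeff_le hα0 (hle i) hα1) (sq_nonneg _))
      ((b.hasSum_inner_sq x).summable.mul_right _)
  refine ⟨hsum, ?_⟩
  set F : ℕ → ℝ → ℝ := fun i t =>
    ⟪x, b i⟫ ^ 2 * (α * Real.exp (-(α * t)) * (Real.exp (lam i * t) - 1) ^ 2) with hF
  have hFint (i : ℕ) : Integrable (F i) (volume.restrict (Set.Ioi 0)) :=
    (laplace_exp_sub_one_sq hα0 (hlam i)).1.const_mul _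
  have hFval (i : ℕ) : ∫ t in Set.Ioi (0 : ℝ), F i t
      = ⟪x, b i⟫ ^ 2 * (2 * lam i ^ 2 / ((α - 2 * lam i) * (α - lam i))) := by
    rw [hF, integral_const_mul, (laplace_exp_sub_one_sq hα0 (hlam i)).2]
  have hFnorm (i : ℕ) (t : ℝ) : ‖F i t‖ = F i t :=
    Real.norm_of_nonneg (by positivity)
  have key := hasSum_integral_of_summable_integral_norm hFint
    (by simpa only [hFnorm, hFval] using hsum)
  simp only [hFval] at key
  rw [key.tsum_eq]
  refine setIntegral_congr_fun measurableSet_Ioi fun t ht => ?_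
  have hd := ((b.hasSum_inner_sq (T t x - x)).mul_left (α * Real.exp (-(α * t)))).tsum_eq
  refine hd.symm.trans (tsum_congr fun i => ?_)
  rw [inner_sub_left, hTeig t (le_of_lt ht)]
  simp only [hF]
  ring
end
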